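/- Let φ : ℂ[P₁₁₁,…,P₂₂₂] → ℂ[α₀,α₁₂,α₁₃,α₂₃,α₁₂₃,a₁,a₂,b₁,b₂,c₁,c₂] be the ℂ-algebra homomorphism defined on the variables by φ(P_{ijk}) = α₀·aᵢbⱼc_k + α₁₂·δ(i=j)/4 + α₁₃·δ(i=k)/4 + α₂₃·δ(j=k)/4 + α₁₂₃·δ(i=j=k)/2, for i,j,k ∈ {1,2}. Then φ is injective, i.e., ker φ = (0); in other words, the pairwise mixture model p-mix₂ is saturated and its model ideal is the null ideal. -/

import Mathlib

open MvPolynomial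

/-- Parameters of the pairwise mixture model `p-mix₂`:
α₀, α₁₂, α₁₃, α₂₃, α₁₂₃, a₁, a₂, b₁, b₂, c₁, c₂. -/
inductive Param : Type
  | a0 : Param
  | a12 : Param
  | a13 : Param
  | a23 : Param
  | a123 : Param
  | a : Fin 2 → Param
  | b : Fin 2 → Param
  | c : Fin 2 → Param

/-- The parametrization map of the model `p-mix₂` (n = 2):
`P_{ijk} ↦ α₀ aᵢ bⱼ c_k + α₁₂ δ(i=j)/4 + α₁₃ δ(i=k)/4 + α₂₃ δ(j=k)/4 + α₁₂₃ δ(i=j=k)/2`.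
Indices in `Fin 2`: `0` stands for `1` and `1` stands for `2`. -/
noncomputable def phi : MvPolynomial (Fin 2 × Fin 2 × Fin 2) ℂ →ₐ[ℂ] MvPolynomial Param ℂ :=
  aeval fun v : Fin 2 × Fin 2 × Fin 2 =>
    X Param.a0 * X (Param.a v.1) * X (Param.b v.2.1) * X (Param.c v.2.2) +
      (if v.1 = v.2.1 then C (1 / 4 : ℂ) * X Param.a12 else 0) +
      (if v.1 = v.2.2 then C (1 / 4 : ℂ) * X Param.a13 else 0) +
      (if v.2.1 = v.2.2 then C (1 / 4 : ℂ) * X Param.a23 else 0) +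
      (if v.1 = v.2.1 ∧ v.2.1 = v.2.2 then C (1 / 2 : ℂ) * X Param.a123 else 0)

lemma rank_one_aux (u v s t : ℂ) (h : u * v = s * t) :
    ∃ a0 a1 b0 b1 : ℂ, a0 * b0 = u ∧ a0 * b1 = s ∧ a1 * b0 = t ∧ a1 * b1 = v := by
  by_cases hu : u = 0
  · subst hu
    have h' : s = 0 ∨ t = 0 := by
      rw [zero_mul] at h
      exact mul_eq_zero.mp h.symm
    rcases h' with h' | h'
    · exact ⟨0, 1, t, v, by simp, by simp [h'], by simp, by simp⟩
    · exact ⟨s, v, 0, 1, by simp, by simp, by simp [h'], by simp⟩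
  · refine ⟨1, t / u, u, s, by simp, by simp, by field_simp, ?_⟩
    field_simp
    linear_combination -h

lemma diff_aux (d0 d1 d2 d3 : ℂ) (hB : d0 * d1 - d2 * d3 ≠ 0)
    (h1 : (d0 - d1) ^ 2 - (d2 - d3) ^ 2 ≠ 0) (h2 : (d0 + d1) ^ 2 - (d2 + d3) ^ 2 ≠ 0) :
    ∃ a0 a1 b0 b1 c0 c1 : ℂ, a0 * b0 * c0 - a1 * b1 * c1 = d0 ∧
      a0 * b0 * c1 - a1 * b1 * c0 = d1 ∧ a0 * b1 * c0 - a1 * b0 * c1 = d2 ∧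
      a0 * b1 * c1 - a1 * b0 * c0 = d3 := by
  obtain ⟨r, hr⟩ : ∃ r : ℂ, (d0 * d1 - d2 * d3) * (r * r) +
      (-(d0 ^ 2 + d1 ^ 2 - d2 ^ 2 - d3 ^ 2)) * r + (d0 * d1 - d2 * d3) = 0 := by
    obtain ⟨w, hw⟩ := IsAlgClosed.exists_pow_nat_eq
      (discrim (d0 * d1 - d2 * d3) (-(d0 ^ 2 + d1 ^ 2 - d2 ^ 2 - d3 ^ 2)) (d0 * d1 - d2 * d3))
      (n := 2) (by norm_num)
    exact exists_quadratic_eq_zero hB ⟨w, by rw [← hw]; ring⟩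
  have hr1 : r - 1 ≠ 0 := by
    intro h
    have : r = 1 := by linear_combination h
    subst this
    exact h1 (by linear_combination -hr)
  have hr2 : r + 1 ≠ 0 := by
    intro h
    have : r = -1 := by linear_combination h
    subst this
    exact h2 (by linear_combination hr)
  have hq : r ^ 2 - 1 ≠ 0 := by
    have := mul_ne_zero hr1 hr2
    intro h
    exact this (by linear_combination h)
  obtain ⟨a0, a1, b0, b1, e1, e2, e3, e4⟩ := rank_one_aux
    ((d0 * r - d1) / (r ^ 2 - 1)) ((d0 - d1 * r) / (r ^ 2 - 1))
    ((d2 * r - d3) / (r ^ 2 - 1)) ((d2 - d3 * r) / (r ^ 2 - 1)) (by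
      field_simp
      linear_combination -hr)
  refine ⟨a0, a1, b0, b1, r, 1, ?_, ?_, ?_, ?_⟩ 
  · rw [e1, e4]
    field_simp
    ring
  · rw [e1, e4]
    field_simp
    ring
  · rw [e2, e3]
    field_simp
    ring
  · rw [e2, e3]
    field_simp
    ring

/-- The nonvanishing polynomial. -/
noncomputable def discPoly : MvPolynomial (Fin 2 × Fin 2 × Fin 2) ℂ :=
  let d0 := X (0, 0, 0) - X (1, 1, 1)
  let d1 := X (0, 0, 1) - X (1, 1, 0)
  let d2 := X (0, 1, 0) - X (1, 0, 1)
  let d3 := X (0, 1, 1) - X (1, 0, 0)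
  (d0 * d1 - d2 * d3) * ((d0 - d1) ^ 2 - (d2 - d3) ^ 2) * ((d0 + d1) ^ 2 - (d2 + d3) ^ 2)

lemma discPoly_ne_zero : discPoly ≠ 0 := by
  intro h
  have := congrArg (eval (fun v : Fin 2 × Fin 2 × Fin 2 =>
    if v = (0, 0, 0) then (3 : ℂ) else if v.1 = 0 then 1 else 0)) h
  simp [discPoly] at this
  norm_num at this

lemma surj_aux (P : Fin 2 × Fin 2 × Fin 2 → ℂ) (hP : eval P discPoly ≠ 0) :
    ∃ θ : Param → ℂ, ∀ p, eval θ (phi p) = eval P p := by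
  simp only [discPoly, map_mul, map_sub, map_add, map_pow, eval_X] at hP
  obtain ⟨hP, h2⟩ := mul_ne_zero_iff.mp hP
  obtain ⟨h0, h1⟩ := mul_ne_zero_iff.mp hP
  obtain ⟨a0, a1, b0, b1, c0, c1, e0, e1, e2, e3⟩ := diff_aux _ _ _ _ h0 h1 h2
  let x := 4 * (P (0, 0, 1) - a0 * b0 * c1)
  let y := 4 * (P (0, 1, 0) - a0 * b1 * c0)
  let z := 4 * (P (0, 1, 1) - a0 * b1 * c1)
  let w := 2 * (P (0, 0, 0) - a0 * b0 * c0 - (x + y + z) / 4)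
  let θ : Param → ℂ := fun q => match q with
    | .a0 => 1
    | .a12 => x
    | .a13 => y
    | .a23 => z
    | .a123 => w
    | .a i => ![a0, a1] i
    | .b i => ![b0, b1] i
    | .c i => ![c0, c1] i
  refine ⟨θ, fun p => ?_⟩
  have key : ((aeval θ).comp phi : MvPolynomial (Fin 2 × Fin 2 × Fin 2) ℂ →ₐ[ℂ] ℂ) = aeval P := by
    apply MvPolynomial.algHom_ext
    rintro ⟨i, j, k⟩
    fin_cases i <;> fin_cases j <;> fin_cases k <;> simp [phi, θ, x, y, z, w]
    · ring
    · linear_combination -e3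
    · linear_combination -e2
    · linear_combination -e1
    · linear_combination -e0
  have := DFunLike.congr_fun key p
  simpa [aeval_eq_eval] using this

/-- The parametrization map of `p-mix₂` is injective: its kernel is the null ideal,
i.e. the model `p-mix₂` is saturated. -/
theorem pmix2_saturated : RingHom.ker phi = ⊥ := by
  rw [eq_bot_iff]
  intro p hp
  rw [RingHom.mem_ker] at hp
  have h : p * discPoly = 0 := by
    apply MvPolynomial.funext
    intro P
    rw [map_mul, map_zero]
    by_cases hP : eval P discPoly = 0
    · rw [hP, mul_zero]
    · obtain ⟨θ, hθ⟩ := surj_aux P hP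
      rw [← hθ p, hp, map_zero, zero_mul]
  exact (mul_eq_zero.mp h).resolve_right discPoly_ne_zero
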